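/- Let ε be an edge-weight function and υ a vertex-weight function on a finite set V with n = |V| ≥ 2, let λ_2 be the second smallest weighted Laplacian eigenvalue of (ε,υ), and let θ(ε,υ) = min over all ∅ ⊊ S ⊊ V of θ(S) be the isoperimetric constant. Then λ_2/2 ≤ θ(ε,υ) ≤ sqrt(2·λ_2·max_{v ∈ V} (d_ε(v)/υ(v))). -/

import Mathlib

open Matrix Polynomial
open scoped Classical

/-- The combinatorial Laplacian of an edge-weight function. -/
noncomputable def lapMat {V : Type} [Fintype V] [DecidableEq V] (ε : V → V → ℝ) :
    Matrix V V ℝ :=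
  Matrix.diagonal (fun v => ∑ u, ε v u) - Matrix.of ε

/-- The weighted Laplacian `W(υ)⁻¹ · L(ε)`, whose eigenvalues coincide with those of
the symmetric matrix `W(υ)^{-1/2} L(ε) W(υ)^{-1/2}`. -/
noncomputable def wlap {V : Type} [Fintype V] [DecidableEq V]
    (ε : V → V → ℝ) (υ : V → ℝ) : Matrix V V ℝ :=
  Matrix.diagonal (fun v => (υ v)⁻¹) * lapMat ε

lemma Multiset.exists_equiv_of_map_univ_eq {α β γ : Type*} [Fintype α] [Fintype β]
    {f : α → γ} {g : β → γ}
    (h : Multiset.map f Finset.univ.val = Multiset.map g Finset.univ.val) :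
    ∃ e : α ≃ β, ∀ a, f a = g (e a) := by
  have key : ∀ c, Nonempty ({a // f a = c} ≃ {b // g b = c}) := by
    intro c
    refine Fintype.card_eq.mp ?_
    have hc := congrArg (Multiset.count c) h
    rw [Multiset.count_map, Multiset.count_map] at hc
    rw [Fintype.card_subtype, Fintype.card_subtype]
    simpa [Finset.card_def, Finset.filter_val, eq_comm] using hc
  exact ⟨Equiv.ofFiberEquiv fun c => (key c).some,
    fun a => (Equiv.ofFiberEquiv_map (fun c => (key c).some) a).symm⟩

section WeightedLaplacian

variable {V : Type} [Fintype V] {ε : V → V → ℝ} {υ : V → ℝ}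

/-- The quadratic form of the combinatorial Laplacian. -/
noncomputable def dirichletEnergy (ε : V → V → ℝ) (f : V → ℝ) : ℝ :=
  (∑ u, ∑ v, ε u v * (f u - f v) ^ 2) / 2

lemma dirichletEnergy_nonneg (hnonneg : ∀ u v, 0 ≤ ε u v) (f : V → ℝ) :
    0 ≤ dirichletEnergy ε f :=
  div_nonneg (Finset.sum_nonneg fun u _ => Finset.sum_nonneg fun v _ =>
    mul_nonneg (hnonneg u v) (sq_nonneg _)) zero_le_two

/-- Every function has a weighted median. -/
lemma exists_weighted_median [Nonempty V] (hυ : ∀ v, 0 < υ v) (g : V → ℝ) :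
    ∃ c, 2 * ∑ v with c < g v, υ v ≤ ∑ v, υ v ∧ 2 * ∑ v with g v < c, υ v ≤ ∑ v, υ v := by
  set P := Finset.univ.filter fun w => ∑ v, υ v ≤ 2 * ∑ v with g v ≤ g w, υ v with hP
  have hPne : P.Nonempty := by
    obtain ⟨w, -, hw⟩ := Finset.univ.exists_max_image g Finset.univ_nonempty
    refine ⟨w, ?_⟩
    have h0 : 0 ≤ ∑ v, υ v := Finset.sum_nonneg fun v _ => (hυ v).le
    rw [hP, Finset.mem_filter, Finset.filter_true_of_mem fun v hv => hw v hv]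
    exact ⟨Finset.mem_univ _, by linarith⟩
  obtain ⟨w, hwP, hwmin⟩ := P.exists_min_image g hPne
  refine ⟨g w, ?_, ?_⟩
  · have h1 := (Finset.mem_filter.1 hwP).2
    have h2 := Finset.sum_filter_add_sum_filter_not Finset.univ (fun v => g v ≤ g w) υ
    simp only [not_le] at h2
    linarith
  · rcases (Finset.univ.filter fun v => g v < g w).eq_empty_or_nonempty with he | hne
    · rw [he, Finset.sum_empty, mul_zero]
      exact Finset.sum_nonneg fun v _ => (hυ v).le
    · obtain ⟨x, hx, hxmax⟩ := Finset.exists_max_image _ g hne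
      have hxw := (Finset.mem_filter.1 hx).2
      have hxP : x ∉ P := fun h => (hwmin x h).not_gt hxw
      have hxlt : 2 * ∑ v with g v ≤ g x, υ v < ∑ v, υ v := by
        simpa [hP] using hxP
      have heq : (Finset.univ.filter fun v => g v < g w) =
          Finset.univ.filter fun v => g v ≤ g x := by
        ext v
        simp only [Finset.mem_filter, Finset.mem_univ, true_and]
        exact ⟨fun hv => hxmax v (by simpa using hv), fun hv => hv.trans_lt hxw⟩
      rw [heq]
      exact hxlt.le

variable [DecidableEq V]

lemma lapMat_mulVec_apply (f : V → ℝ) (v : V) :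
    (lapMat ε *ᵥ f) v = ∑ u, ε v u * (f v - f u) := by
  simp only [lapMat, Matrix.sub_mulVec, Pi.sub_apply, Matrix.mulVec_diagonal, Finset.sum_mul,
    mul_sub, Finset.sum_sub_distrib]
  rfl

lemma lapMat_isSymm (hsym : ∀ u v, ε u v = ε v u) : (lapMat ε).IsSymm := by
  unfold Matrix.IsSymm lapMat
  rw [Matrix.transpose_sub, Matrix.diagonal_transpose]
  congr 1
  ext u v
  exact hsym v u

lemma dotProduct_lapMat_mulVec (hsym : ∀ u v, ε u v = ε v u) (f : V → ℝ) :
    f ⬝ᵥ (lapMat ε *ᵥ f) = dirichletEnergy ε f := by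
  have h1 : f ⬝ᵥ (lapMat ε *ᵥ f) = ∑ u, ∑ v, ε u v * (f u * (f u - f v)) := by
    simp only [dotProduct, lapMat_mulVec_apply, Finset.mul_sum]
    exact Finset.sum_congr rfl fun u _ => Finset.sum_congr rfl fun v _ => by ring
  have h2 : f ⬝ᵥ (lapMat ε *ᵥ f) = ∑ u, ∑ v, ε u v * (f v * (f v - f u)) := by
    rw [h1, Finset.sum_comm]
    exact Finset.sum_congr rfl fun u _ => Finset.sum_congr rfl fun v _ => by rw [hsym]
  have h3 : dirichletEnergy ε f * 2 = f ⬝ᵥ (lapMat ε *ᵥ f) + f ⬝ᵥ (lapMat ε *ᵥ f) := by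
    nth_rw 1 [h1]
    rw [h2, dirichletEnergy, div_mul_cancel₀ _ two_ne_zero]
    simp only [← Finset.sum_add_distrib]
    exact Finset.sum_congr rfl fun u _ => Finset.sum_congr rfl fun v _ => by ring
  linarith

lemma lapMat_mulVec_const (c : ℝ) : lapMat ε *ᵥ (fun _ => c) = 0 := by
  ext v
  simp [lapMat_mulVec_apply]

/-- A basis of eigenvectors of the weighted Laplacian, orthonormal for the inner product
weighted by `υ`, with eigenvalues listed by `lam`. -/
structure IsWeightedEigenbasis {n : ℕ} (ε : V → V → ℝ) (υ : V → ℝ) (lam : Fin n → ℝ)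
    (b : Fin n → V → ℝ) : Prop where
  orthonormal : ∀ i j, ∑ v, υ v * b i v * b j v = if i = j then 1 else 0
  eigen : ∀ i v, (lapMat ε *ᵥ b i) v = lam i * (υ v * b i v)
  expand : ∀ (f : V → ℝ) v, f v = ∑ i, (∑ u, υ u * f u * b i u) * b i v

lemma exists_isWeightedEigenbasis (hsym : ∀ u v, ε u v = ε v u) (hυ : ∀ v, 0 < υ v)
    {n : ℕ} (lam : Fin n → ℝ) (hlam : (wlap ε υ).charpoly = ∏ i, (X - C (lam i))) :
    ∃ b, IsWeightedEigenbasis ε υ lam b := by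
  set s : V → ℝ := fun v => Real.sqrt (υ v)
  have hs0 : ∀ v, s v ≠ 0 := fun v => (Real.sqrt_pos.2 (hυ v)).ne'
  have hss : ∀ v, υ v = s v * s v := fun v => (Real.mul_self_sqrt (hυ v).le).symm
  set D : Matrix V V ℝ := Matrix.diagonal fun v => (s v)⁻¹ with hD
  have hA : (D * lapMat ε * D).IsHermitian := by
    have : (D * lapMat ε * D)ᵀ = D * lapMat ε * D := by
      rw [Matrix.transpose_mul, Matrix.transpose_mul, (lapMat_isSymm hsym).eq, hD,
        Matrix.diagonal_transpose, Matrix.mul_assoc]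
    rwa [Matrix.IsHermitian, Matrix.conjTranspose_eq_transpose_of_trivial]
  have hchar : (D * lapMat ε * D).charpoly = (wlap ε υ).charpoly := by
    rw [Matrix.charpoly_mul_comm, ← Matrix.mul_assoc, hD, Matrix.diagonal_mul_diagonal, wlap]
    congr 3
    ext v
    rw [hss v, mul_inv]
  have hroots : Multiset.map lam Finset.univ.val =
      Multiset.map hA.eigenvalues Finset.univ.val := by
    have h1 := hA.roots_charpoly_eq_eigenvalues
    have h2 : (∏ i, (X - C (lam i))).roots = Multiset.map lam Finset.univ.val := by
      have := Polynomial.roots_multiset_prod_X_sub_C (Multiset.map lam Finset.univ.val)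
      rw [Multiset.map_map] at this
      exact this
    rw [hchar, hlam, h2] at h1
    exact h1
  obtain ⟨e, he⟩ := Multiset.exists_equiv_of_map_univ_eq hroots
  set B := hA.eigenvectorBasis with hB
  refine ⟨fun i v => (s v)⁻¹ * B (e i) v, ?_, ?_, ?_⟩
  · intro i j
    have h := (orthonormal_iff_ite.1 B.orthonormal) (e i) (e j)
    simp only [EmbeddingLike.apply_eq_iff_eq] at h
    rw [← h, PiLp.inner_apply]
    refine Finset.sum_congr rfl fun v _ => ?_
    simp only [RCLike.inner_apply, conj_trivial]
    rw [hss v]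
    field_simp [hs0 v]
  · intro i v
    have h := congrFun (hA.mulVec_eigenvectorBasis (e i)) v
    have hDv : ∀ (x : V → ℝ) u, (D *ᵥ x) u = (s u)⁻¹ * x u := fun x u => by
      rw [hD, Matrix.mulVec_diagonal]
    have hDB : D *ᵥ (B (e i)).ofLp = fun u => (s u)⁻¹ * B (e i) u := funext (hDv _)
    rw [← he i, ← Matrix.mulVec_mulVec, ← Matrix.mulVec_mulVec, hDv, hDB, Pi.smul_apply,
      smul_eq_mul, inv_mul_eq_iff_eq_mul₀ (hs0 v)] at h
    rw [h, hss v, ← hB]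
    field_simp [hs0 v]
  · intro f v
    have h := congrArg (fun x : EuclideanSpace ℝ V => x v)
      (B.sum_repr' (WithLp.toLp 2 fun v => s v * f v))
    simp only [WithLp.ofLp_sum, Finset.sum_apply, PiLp.smul_apply, smul_eq_mul] at h
    have h' : f v = (s v)⁻¹ * (s v * f v) := by field_simp [hs0 v]
    rw [h', ← h, Finset.mul_sum, ← e.sum_comp]
    refine Finset.sum_congr rfl fun i _ => ?_
    rw [PiLp.inner_apply, mul_left_comm]
    congr 1
    refine Finset.sum_congr rfl fun u _ => ?_
    simp only [RCLike.inner_apply, conj_trivial]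
    rw [hss u]
    field_simp [hs0 u]

namespace IsWeightedEigenbasis

variable {n : ℕ} {lam : Fin n → ℝ} {b : Fin n → V → ℝ}

lemma sum_sq (hb : IsWeightedEigenbasis ε υ lam b) (f : V → ℝ) :
    ∑ v, υ v * f v ^ 2 = ∑ i, (∑ u, υ u * f u * b i u) ^ 2 := by
  have h : ∀ v, υ v * f v ^ 2 = ∑ i, (∑ u, υ u * f u * b i u) * (υ v * f v * b i v) := by
    intro v
    calc υ v * f v ^ 2 = υ v * f v * f v := by ring
      _ = υ v * f v * ∑ i, (∑ u, υ u * f u * b i u) * b i v := by rw [← hb.expand f v]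
      _ = _ := by rw [Finset.mul_sum]; exact Finset.sum_congr rfl fun i _ => by ring
  rw [Finset.sum_congr rfl fun v _ => h v, Finset.sum_comm]
  exact Finset.sum_congr rfl fun i _ => by rw [← Finset.mul_sum, sq]

lemma energy (hb : IsWeightedEigenbasis ε υ lam b) (hsym : ∀ u v, ε u v = ε v u) (f : V → ℝ) :
    dirichletEnergy ε f = ∑ i, lam i * (∑ u, υ u * f u * b i u) ^ 2 := by
  have hf : f = ∑ i, (∑ u, υ u * f u * b i u) • b i := by
    ext v
    rw [Finset.sum_apply]
    exact hb.expand f v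
  have hL : lapMat ε *ᵥ f = ∑ i, (∑ u, υ u * f u * b i u) • (lapMat ε *ᵥ b i) := by
    conv_lhs => rw [hf]
    rw [Matrix.mulVec_sum]
    simp only [Matrix.mulVec_smul]
  rw [← dotProduct_lapMat_mulVec hsym, hL, dotProduct_sum]
  refine Finset.sum_congr rfl fun i _ => ?_
  have : f ⬝ᵥ (lapMat ε *ᵥ b i) = lam i * ∑ u, υ u * f u * b i u := by
    simp only [dotProduct, hb.eigen, Finset.mul_sum]
    exact Finset.sum_congr rfl fun v _ => by ring
  rw [dotProduct_smul, this, smul_eq_mul]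
  ring

lemma eigenvalue_mul_sum_eq_zero (hb : IsWeightedEigenbasis ε υ lam b)
    (hsym : ∀ u v, ε u v = ε v u) (i : Fin n) : lam i * ∑ u, υ u * b i u = 0 := by
  have h : (fun _ => (1 : ℝ)) ⬝ᵥ (lapMat ε *ᵥ b i) = lam i * ∑ u, υ u * b i u := by
    simp only [dotProduct, hb.eigen, Finset.mul_sum, one_mul]
  rw [← h, dotProduct_mulVec, ← mulVec_transpose, (lapMat_isSymm hsym).eq,
    lapMat_mulVec_const, zero_dotProduct]

/-- The second smallest eigenvalue bounds the Rayleigh quotient from below on the orthogonal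
complement of the constants. -/
lemma second_eigenvalue_mul_le [Nonempty V] (hb : IsWeightedEigenbasis ε υ lam b)
    (hsym : ∀ u v, ε u v = ε v u) (hnonneg : ∀ u v, 0 ≤ ε u v) (hυ : ∀ v, 0 < υ v)
    (hmono : Monotone lam) (hn2 : 2 ≤ n) {f : V → ℝ} (hf : ∑ v, υ v * f v = 0) :
    lam ⟨1, hn2⟩ * ∑ v, υ v * f v ^ 2 ≤ dirichletEnergy ε f := by
  rcases le_or_gt (lam ⟨1, hn2⟩) 0 with h0 | h0
  · exact (mul_nonpos_of_nonpos_of_nonneg h0 (Finset.sum_nonneg fun v _ =>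
      mul_nonneg (hυ v).le (sq_nonneg _))).trans (dirichletEnergy_nonneg hnonneg f)
  · have hle : ∀ i : Fin n, i ≠ ⟨0, by omega⟩ → lam ⟨1, hn2⟩ ≤ lam i := by
      intro i hi
      apply hmono
      rw [Fin.le_def]
      have : i.val ≠ 0 := fun h => hi (Fin.ext h)
      simp only
      omega
    have hz : ∀ i : Fin n, i ≠ ⟨0, by omega⟩ → ∑ u, υ u * b i u = 0 := fun i hi =>
      (mul_eq_zero.1 (hb.eigenvalue_mul_sum_eq_zero hsym i)).resolve_left
        (h0.trans_le (hle i hi)).ne'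
    have hone : ∀ v, (1 : ℝ) = (∑ u, υ u * b ⟨0, by omega⟩ u) * b ⟨0, by omega⟩ v := by
      intro v
      rw [hb.expand (fun _ => 1) v, Finset.sum_eq_single ⟨0, by omega⟩]
      · simp
      · intro i _ hi
        simp [hz i hi]
      · simp
    have hc : ∑ u, υ u * f u * b ⟨0, by omega⟩ u = 0 := by
      have h1 : (∑ u, υ u * b ⟨0, by omega⟩ u) * ∑ u, υ u * f u * b ⟨0, by omega⟩ u = 0 := by
        rw [← hf, Finset.mul_sum]
        refine Finset.sum_congr rfl fun v _ => ?_
        linear_combination (-(υ v * f v)) * hone v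
      refine (mul_eq_zero.1 h1).resolve_left fun h => ?_
      have := hone (Classical.arbitrary V)
      rw [h, zero_mul] at this
      exact one_ne_zero this
    rw [hb.energy hsym, hb.sum_sq, Finset.mul_sum]
    refine Finset.sum_le_sum fun i _ => ?_
    by_cases hi : i = ⟨0, by omega⟩
    · rw [hi, hc]
      simp
    · exact mul_le_mul_of_nonneg_right (hle i hi) (sq_nonneg _)

/-- Some nonzero vector orthogonal to the constants has Rayleigh quotient at most the second
smallest eigenvalue. -/
lemma exists_energy_le (hb : IsWeightedEigenbasis ε υ lam b)
    (hsym : ∀ u v, ε u v = ε v u) (hmono : Monotone lam) (hn2 : 2 ≤ n) :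
    ∃ g : V → ℝ, ∑ v, υ v * g v = 0 ∧ 0 < ∑ v, υ v * g v ^ 2 ∧
      dirichletEnergy ε g ≤ lam ⟨1, hn2⟩ * ∑ v, υ v * g v ^ 2 := by
  set i₀ : Fin n := ⟨0, by omega⟩ with hi₀
  set i₁ : Fin n := ⟨1, hn2⟩ with hi₁
  have hne : i₀ ≠ i₁ := by simp [hi₀, hi₁]
  obtain ⟨x, y, hxy, hpos⟩ : ∃ x y : ℝ,
      x * ∑ v, υ v * b i₀ v + y * ∑ v, υ v * b i₁ v = 0 ∧ 0 < x ^ 2 + y ^ 2 := by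
    by_cases h : ∑ v, υ v * b i₀ v = 0
    · exact ⟨1, 0, by simp [h], by norm_num⟩
    · exact ⟨∑ v, υ v * b i₁ v, -∑ v, υ v * b i₀ v, by ring,
        add_pos_of_nonneg_of_pos (sq_nonneg _) (sq_pos_of_ne_zero (neg_ne_zero.2 h))⟩
  have hcoef : ∀ i, ∑ u, υ u * (x * b i₀ u + y * b i₁ u) * b i u =
      x * (if i₀ = i then 1 else 0) + y * (if i₁ = i then 1 else 0) := by
    intro i
    rw [← hb.orthonormal, ← hb.orthonormal, Finset.mul_sum, Finset.mul_sum,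
      ← Finset.sum_add_distrib]
    exact Finset.sum_congr rfl fun v _ => by ring
  have hsq : ∀ i, (x * (if i₀ = i then 1 else 0) + y * (if i₁ = i then 1 else 0)) ^ 2 =
      (if i₀ = i then x ^ 2 else 0) + (if i₁ = i then y ^ 2 else 0) := by
    intro i
    by_cases h : i₀ = i
    · have h' : i₁ ≠ i := fun h' => hne (h.trans h'.symm)
      simp [h, h']
    · simp [h]
  have hN : ∑ v, υ v * (x * b i₀ v + y * b i₁ v) ^ 2 = x ^ 2 + y ^ 2 := by
    rw [hb.sum_sq]
    simp only [hcoef, hsq, Finset.sum_add_distrib, Finset.sum_ite_eq, Finset.mem_univ, if_true]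
  refine ⟨fun v => x * b i₀ v + y * b i₁ v, ?_, ?_, ?_⟩
  · rw [← hxy, Finset.mul_sum, Finset.mul_sum, ← Finset.sum_add_distrib]
    exact Finset.sum_congr rfl fun v _ => by ring
  · rwa [hN]
  · rw [hN, hb.energy hsym]
    simp only [hcoef, hsq]
    simp only [mul_add, mul_ite, mul_zero, Finset.sum_add_distrib, Finset.sum_ite_eq,
      Finset.mem_univ, if_true]
    gcongr
    exact hmono (by simp [hi₀, hi₁])

end IsWeightedEigenbasis

/-- The energy of an indicator function is the weight of the cut. -/
lemma sum_sum_indicator_sq (hsym : ∀ u v, ε u v = ε v u) (S : Finset V) :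
    ∑ u, ∑ v, ε u v * ((if u ∈ S then (1 : ℝ) else 0) - if v ∈ S then 1 else 0) ^ 2 =
      2 * ∑ u ∈ S, ∑ v ∈ Sᶜ, ε u v := by
  have h1 : ∀ u ∈ S,
      ∑ v, ε u v * ((if u ∈ S then (1 : ℝ) else 0) - if v ∈ S then 1 else 0) ^ 2 =
        ∑ v ∈ Sᶜ, ε u v := by
    intro u hu
    rw [← Finset.sum_add_sum_compl S, Finset.sum_eq_zero, zero_add]
    · refine Finset.sum_congr rfl fun v hv => ?_
      simp [hu, Finset.mem_compl.1 hv]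
    · intro v hv
      simp [hu, hv]
  have h2 : ∀ u ∈ Sᶜ,
      ∑ v, ε u v * ((if u ∈ S then (1 : ℝ) else 0) - if v ∈ S then 1 else 0) ^ 2 =
        ∑ v ∈ S, ε u v := by
    intro u hu
    rw [← Finset.sum_add_sum_compl S, add_comm, Finset.sum_eq_zero, zero_add]
    · refine Finset.sum_congr rfl fun v hv => ?_
      simp [Finset.mem_compl.1 hu, hv]
    · intro v hv
      simp [Finset.mem_compl.1 hu, Finset.mem_compl.1 hv]
  rw [← Finset.sum_add_sum_compl S, Finset.sum_congr rfl h1, Finset.sum_congr rfl h2,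
    Finset.sum_comm (s := Sᶜ), two_mul]
  congr 1
  exact Finset.sum_congr rfl fun u _ => Finset.sum_congr rfl fun v _ => hsym v u

/-- The discrete coarea inequality for functions supported on at most half of the total weight. -/
lemma mul_sum_le_sum_abs_sub (hsym : ∀ u v, ε u v = ε v u) (hυ : ∀ v, 0 < υ v) {θ : ℝ}
    (hθ : ∀ S : Finset V, S.Nonempty → S ≠ Finset.univ →
      θ * min (∑ v ∈ S, υ v) (∑ v ∈ Sᶜ, υ v) ≤ ∑ u ∈ S, ∑ v ∈ Sᶜ, ε u v)
    (h : V → ℝ) (hh : ∀ v, 0 ≤ h v)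
    (hsupp : 2 * ∑ v with h v ≠ 0, υ v ≤ ∑ v, υ v) :
    2 * (θ * ∑ v, υ v * h v) ≤ ∑ u, ∑ v, ε u v * |h u - h v| := by
  induction hk : (Finset.univ.filter fun v => h v ≠ 0).card using Nat.strong_induction_on
    generalizing h with
  | _ k ih =>
    set T := Finset.univ.filter fun v => h v ≠ 0 with hT
    rcases T.eq_empty_or_nonempty with hemp | hne
    · have hz : ∀ v, h v = 0 := by
        intro v
        by_contra hv
        have : v ∈ T := by simp [hT, hv]
        simp [hemp] at this
      simp [hz]
    · obtain ⟨w, hwT, hwmin⟩ := T.exists_min_image h hne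
      have hmem : ∀ v, v ∈ T ↔ h v ≠ 0 := by simp [hT]
      set h' : V → ℝ := fun v => if v ∈ T then h v - h w else 0 with hh'
      have hsub : (Finset.univ.filter fun v => h' v ≠ 0) ⊂ T := by
        rw [Finset.ssubset_iff_of_subset]
        · exact ⟨w, hwT, by simp [hh']⟩
        · intro v hv
          by_contra hvT
          simp [hh', hvT] at hv
      have hdecomp : ∀ v, h v = h w * (if v ∈ T then 1 else 0) + h' v := by
        intro v
        by_cases hv : v ∈ T
        · simp [hh', hv]
        · have : h v = 0 := not_not.1 fun h0 => hv ((hmem v).2 h0)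
          simp [hh', hv, this]
      have hind := ih _ (hk ▸ Finset.card_lt_card hsub) h'
        (fun v => by
          by_cases hv : v ∈ T
          · simpa [hh', hv] using hwmin v hv
          · simp [hh', hv])
        ((mul_le_mul_of_nonneg_left (Finset.sum_le_sum_of_subset_of_nonneg hsub.subset
          fun v _ _ => (hυ v).le) zero_le_two).trans hsupp) rfl
      have habs : ∀ u v, |h u - h v| =
          h w * ((if u ∈ T then (1 : ℝ) else 0) - if v ∈ T then 1 else 0) ^ 2 +
            |h' u - h' v| := by
        intro u v
        have hu0 := hh u
        have hv0 := hh v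
        have hw0 := hh w
        by_cases hu : u ∈ T <;> by_cases hv : v ∈ T
        · simp [hh', hu, hv]
        · have h0 : h v = 0 := not_not.1 fun h0 => hv ((hmem v).2 h0)
          have := hwmin u hu
          simp only [hh', hu, hv, if_true, if_false, h0, sub_zero]
          rw [abs_of_nonneg hu0, abs_of_nonneg (by linarith)]
          ring
        · have h0 : h u = 0 := not_not.1 fun h0 => hu ((hmem u).2 h0)
          have := hwmin v hv
          simp only [hh', hu, hv, if_true, if_false, h0, zero_sub, abs_neg]
          rw [abs_of_nonneg hv0, abs_of_nonneg (by linarith)]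
          ring
        · have h0 : h u = 0 := not_not.1 fun h0 => hu ((hmem u).2 h0)
          have h1 : h v = 0 := not_not.1 fun h0 => hv ((hmem v).2 h0)
          simp [hh', hu, hv, h0, h1]
      have hsum : ∑ v, υ v * h v = h w * ∑ v ∈ T, υ v + ∑ v, υ v * h' v := by
        have : ∑ v ∈ T, υ v = ∑ v, if v ∈ T then υ v else 0 := by
          rw [Finset.sum_ite_mem, Finset.univ_inter]
        rw [this, Finset.mul_sum, ← Finset.sum_add_distrib]
        refine Finset.sum_congr rfl fun v _ => ?_
        rw [hdecomp v]
        split_ifs <;> ring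
      have hcut : ∑ u, ∑ v, ε u v * |h u - h v| =
          h w * (2 * ∑ u ∈ T, ∑ v ∈ Tᶜ, ε u v) + ∑ u, ∑ v, ε u v * |h' u - h' v| := by
        rw [← sum_sum_indicator_sq hsym T, Finset.mul_sum, ← Finset.sum_add_distrib]
        refine Finset.sum_congr rfl fun u _ => ?_
        rw [Finset.mul_sum, ← Finset.sum_add_distrib]
        refine Finset.sum_congr rfl fun v _ => ?_
        rw [habs u v]
        ring
      have hTpos : 0 < ∑ v ∈ T, υ v := Finset.sum_pos (fun v _ => hυ v) hne
      have hsplit := Finset.sum_add_sum_compl T υ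
      have hTθ := hθ T hne (by
        intro hTu
        rw [hTu] at hsupp hTpos
        linarith)
      rw [min_eq_left (by linarith)] at hTθ
      have := mul_le_mul_of_nonneg_left hTθ (hh w)
      rw [hsum, hcut]
      linarith

/-- The Cheeger estimate for functions supported on at most half of the total weight. -/
lemma sq_mul_sum_sq_le_energy (hsym : ∀ u v, ε u v = ε v u) (hnonneg : ∀ u v, 0 ≤ ε u v)
    (hυ : ∀ v, 0 < υ v) {θ M : ℝ} (hθ0 : 0 ≤ θ) (hM0 : 0 ≤ M)
    (hM : ∀ v, ∑ u, ε v u ≤ M * υ v)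
    (hθ : ∀ S : Finset V, S.Nonempty → S ≠ Finset.univ →
      θ * min (∑ v ∈ S, υ v) (∑ v ∈ Sᶜ, υ v) ≤ ∑ u ∈ S, ∑ v ∈ Sᶜ, ε u v)
    (f : V → ℝ) (hsupp : 2 * ∑ v with f v ≠ 0, υ v ≤ ∑ v, υ v) :
    θ ^ 2 * ∑ v, υ v * f v ^ 2 ≤ 2 * M * dirichletEnergy ε f := by
  set N := ∑ v, υ v * f v ^ 2 with hN
  have hE0 := dirichletEnergy_nonneg hnonneg f
  have hN0 : 0 ≤ N := Finset.sum_nonneg fun v _ => mul_nonneg (hυ v).le (sq_nonneg _)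
  have hco := mul_sum_le_sum_abs_sub hsym hυ hθ (fun v => f v ^ 2) (fun v => sq_nonneg _)
    (by simpa using hsupp)
  have hcs : (∑ u, ∑ v, ε u v * |f u ^ 2 - f v ^ 2|) ^ 2 ≤
      (∑ u, ∑ v, ε u v * (f u - f v) ^ 2) * ∑ u, ∑ v, ε u v * (f u + f v) ^ 2 := by
    simp only [← Fintype.sum_prod_type']
    refine Finset.sum_sq_le_sum_mul_sum_of_sq_le_mul _
      (fun p _ => mul_nonneg (hnonneg _ _) (sq_nonneg _))
      (fun p _ => mul_nonneg (hnonneg _ _) (sq_nonneg _)) fun p _ => ?_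
    rw [mul_pow, sq_abs]
    exact le_of_eq (by ring)
  have hplus : ∑ u, ∑ v, ε u v * (f u + f v) ^ 2 ≤ 4 * (M * N) := by
    have h1 : ∑ u, ∑ v, ε u v * f u ^ 2 ≤ M * N := by
      rw [hN, Finset.mul_sum]
      refine Finset.sum_le_sum fun u _ => ?_
      rw [← Finset.sum_mul, ← mul_assoc]
      exact mul_le_mul_of_nonneg_right (hM u) (sq_nonneg _)
    have h2 : ∑ u, ∑ v, ε u v * f v ^ 2 = ∑ u, ∑ v, ε u v * f u ^ 2 := by
      rw [Finset.sum_comm]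
      exact Finset.sum_congr rfl fun u _ => Finset.sum_congr rfl fun v _ => by rw [hsym]
    calc ∑ u, ∑ v, ε u v * (f u + f v) ^ 2
        ≤ ∑ u, ∑ v, (2 * (ε u v * f u ^ 2) + 2 * (ε u v * f v ^ 2)) := by
          refine Finset.sum_le_sum fun u _ => Finset.sum_le_sum fun v _ => ?_
          nlinarith [mul_nonneg (hnonneg u v) (sq_nonneg (f u - f v))]
      _ = 2 * ∑ u, ∑ v, ε u v * f u ^ 2 + 2 * ∑ u, ∑ v, ε u v * f v ^ 2 := by
          simp only [Finset.sum_add_distrib, Finset.mul_sum]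
      _ ≤ 4 * (M * N) := by rw [h2]; linarith
  have hmain : (2 * (θ * N)) ^ 2 ≤ 2 * dirichletEnergy ε f * (4 * (M * N)) := by
    refine (pow_le_pow_left₀ (by positivity) hco 2).trans (hcs.trans ?_)
    rw [show 2 * dirichletEnergy ε f = ∑ u, ∑ v, ε u v * (f u - f v) ^ 2 by
      unfold dirichletEnergy; ring]
    refine mul_le_mul_of_nonneg_left hplus ?_
    exact Finset.sum_nonneg fun u _ => Finset.sum_nonneg fun v _ =>
      mul_nonneg (hnonneg u v) (sq_nonneg _)
  rcases hN0.eq_or_lt with h0 | h0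
  · rw [← h0, mul_zero]
    positivity
  · refine le_of_mul_le_mul_right ?_ h0
    nlinarith

/-- The Cheeger estimate for functions orthogonal to the constants. -/
lemma sq_mul_sum_sq_le_energy_of_sum_eq_zero [Nonempty V] (hsym : ∀ u v, ε u v = ε v u)
    (hnonneg : ∀ u v, 0 ≤ ε u v) (hυ : ∀ v, 0 < υ v) {θ M : ℝ} (hθ0 : 0 ≤ θ) (hM0 : 0 ≤ M)
    (hM : ∀ v, ∑ u, ε v u ≤ M * υ v)
    (hθ : ∀ S : Finset V, S.Nonempty → S ≠ Finset.univ →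
      θ * min (∑ v ∈ S, υ v) (∑ v ∈ Sᶜ, υ v) ≤ ∑ u ∈ S, ∑ v ∈ Sᶜ, ε u v)
    (g : V → ℝ) (hg : ∑ v, υ v * g v = 0) :
    θ ^ 2 * ∑ v, υ v * g v ^ 2 ≤ 2 * M * dirichletEnergy ε g := by
  obtain ⟨c, hc1, hc2⟩ := exists_weighted_median hυ g
  have hp := sq_mul_sum_sq_le_energy hsym hnonneg hυ hθ0 hM0 hM hθ (fun v => max (g v - c) 0) (by
      convert hc1 using 4 with v
      simp)
  have hm := sq_mul_sum_sq_le_energy hsym hnonneg hυ hθ0 hM0 hM hθ (fun v => max (c - g v) 0) (by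
      convert hc2 using 4 with v
      simp)
  have hN : ∑ v, υ v * g v ^ 2 ≤
      ∑ v, υ v * max (g v - c) 0 ^ 2 + ∑ v, υ v * max (c - g v) 0 ^ 2 := by
    have h1 : ∑ v, υ v * max (g v - c) 0 ^ 2 + ∑ v, υ v * max (c - g v) 0 ^ 2 =
        ∑ v, υ v * g v ^ 2 - 2 * c * ∑ v, υ v * g v + ∑ v, υ v * c ^ 2 := by
      rw [← Finset.sum_add_distrib, Finset.mul_sum, ← Finset.sum_sub_distrib,
        ← Finset.sum_add_distrib]
      refine Finset.sum_congr rfl fun v _ => ?_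
      rcases le_total (g v) c with h | h
      · rw [max_eq_right (by linarith), max_eq_left (by linarith)]
        ring
      · rw [max_eq_left (by linarith), max_eq_right (by linarith)]
        ring
    rw [h1, hg, mul_zero, sub_zero]
    exact le_add_of_nonneg_right
      (Finset.sum_nonneg fun v _ => mul_nonneg (hυ v).le (sq_nonneg _))
  have hE : dirichletEnergy ε (fun v => max (g v - c) 0) +
      dirichletEnergy ε (fun v => max (c - g v) 0) ≤ dirichletEnergy ε g := by
    unfold dirichletEnergy
    rw [← add_div, ← Finset.sum_add_distrib]
    refine div_le_div_of_nonneg_right (Finset.sum_le_sum fun u _ => ?_) zero_le_two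
    rw [← Finset.sum_add_distrib]
    refine Finset.sum_le_sum fun v _ => ?_
    rw [← mul_add]
    refine mul_le_mul_of_nonneg_left ?_ (hnonneg u v)
    beta_reduce
    rcases le_total (g u) c with hu | hu <;> rcases le_total (g v) c with hv | hv
    · rw [max_eq_right (a := g u - c) (by linarith), max_eq_left (a := c - g u) (by linarith),
        max_eq_right (a := g v - c) (by linarith), max_eq_left (a := c - g v) (by linarith)]
      nlinarith
    · rw [max_eq_right (a := g u - c) (by linarith), max_eq_left (a := c - g u) (by linarith),
        max_eq_left (a := g v - c) (by linarith), max_eq_right (a := c - g v) (by linarith)]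
      nlinarith [mul_nonneg (sub_nonneg.2 hu) (sub_nonneg.2 hv)]
    · rw [max_eq_left (a := g u - c) (by linarith), max_eq_right (a := c - g u) (by linarith),
        max_eq_right (a := g v - c) (by linarith), max_eq_left (a := c - g v) (by linarith)]
      nlinarith [mul_nonneg (sub_nonneg.2 hu) (sub_nonneg.2 hv)]
    · rw [max_eq_left (a := g u - c) (by linarith), max_eq_right (a := c - g u) (by linarith),
        max_eq_left (a := g v - c) (by linarith), max_eq_right (a := c - g v) (by linarith)]
      nlinarith
  calc θ ^ 2 * ∑ v, υ v * g v ^ 2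
      ≤ θ ^ 2 * (∑ v, υ v * max (g v - c) 0 ^ 2 + ∑ v, υ v * max (c - g v) 0 ^ 2) :=
        mul_le_mul_of_nonneg_left hN (sq_nonneg θ)
    _ ≤ 2 * M * (dirichletEnergy ε (fun v => max (g v - c) 0) +
          dirichletEnergy ε (fun v => max (c - g v) 0)) := by
        rw [mul_add, mul_add]
        exact add_le_add hp hm
    _ ≤ 2 * M * dirichletEnergy ε g := mul_le_mul_of_nonneg_left hE (by positivity)

/-- The second smallest eigenvalue is at most twice the isoperimetric ratio of any set. -/
lemma IsWeightedEigenbasis.second_eigenvalue_div_two_le {n : ℕ} {lam : Fin n → ℝ}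
    {b : Fin n → V → ℝ} (hb : IsWeightedEigenbasis ε υ lam b)
    (hsym : ∀ u v, ε u v = ε v u) (hnonneg : ∀ u v, 0 ≤ ε u v) (hυ : ∀ v, 0 < υ v)
    (hmono : Monotone lam) (hn2 : 2 ≤ n) {S : Finset V} (hS : S.Nonempty)
    (hS' : S ≠ Finset.univ) :
    lam ⟨1, hn2⟩ / 2 ≤
      (∑ u ∈ S, ∑ v ∈ Sᶜ, ε u v) / min (∑ v ∈ S, υ v) (∑ v ∈ Sᶜ, υ v) := by
  have hSc : Sᶜ.Nonempty := by
    rwa [Finset.nonempty_iff_ne_empty, Ne, Finset.compl_eq_empty_iff]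
  have : Nonempty V := ⟨hS.choose⟩
  set x := ∑ v ∈ S, υ v with hx
  set y := ∑ v ∈ Sᶜ, υ v with hy
  set k := ∑ u ∈ S, ∑ v ∈ Sᶜ, ε u v with hk
  have hx0 : 0 < x := Finset.sum_pos (fun v _ => hυ v) hS
  have hy0 : 0 < y := Finset.sum_pos (fun v _ => hυ v) hSc
  have hk0 : 0 ≤ k := Finset.sum_nonneg fun u _ => Finset.sum_nonneg fun v _ => hnonneg u v
  set f : V → ℝ := fun v => (x + y) * (if v ∈ S then 1 else 0) - x with hf
  have hfS : ∀ v ∈ S, f v = y := fun v hv => by simp [hf, hv]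
  have hfSc : ∀ v ∈ Sᶜ, f v = -x := fun v hv => by simp [hf, Finset.mem_compl.1 hv]
  have hsum : ∑ v, υ v * f v = 0 := by
    rw [← Finset.sum_add_sum_compl S, Finset.sum_congr rfl fun v hv => by rw [hfS v hv],
      Finset.sum_congr (s₁ := Sᶜ) rfl fun v hv => by rw [hfSc v hv], ← Finset.sum_mul,
      ← Finset.sum_mul]
    ring
  have hsq : ∑ v, υ v * f v ^ 2 = x * y ^ 2 + y * x ^ 2 := by
    rw [← Finset.sum_add_sum_compl S, Finset.sum_congr rfl fun v hv => by rw [hfS v hv],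
      Finset.sum_congr (s₁ := Sᶜ) rfl fun v hv => by rw [hfSc v hv], ← Finset.sum_mul,
      ← Finset.sum_mul]
    ring
  have hE : dirichletEnergy ε f = (x + y) ^ 2 * k := by
    have h := sum_sum_indicator_sq hsym S
    have h2 : ∑ u, ∑ v, ε u v * (f u - f v) ^ 2 = (x + y) ^ 2 * (2 * k) := by
      rw [hk, ← h, Finset.mul_sum]
      refine Finset.sum_congr rfl fun u _ => ?_
      rw [Finset.mul_sum]
      exact Finset.sum_congr rfl fun v _ => by simp only [hf]; ring
    rw [dirichletEnergy, h2]
    ring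
  have hray := hb.second_eigenvalue_mul_le hsym hnonneg hυ hmono hn2 hsum
  rw [hsq, hE] at hray
  have hray' : lam ⟨1, hn2⟩ * (x * y) ≤ (x + y) * k :=
    le_of_mul_le_mul_right (by linarith) (add_pos hx0 hy0)
  rw [le_div_iff₀ (lt_min hx0 hy0)]
  rcases le_total x y with h | h
  · rw [min_eq_left h]
    refine le_of_mul_le_mul_right ?_ hy0
    nlinarith [mul_le_mul_of_nonneg_right h hk0]
  · rw [min_eq_right h]
    refine le_of_mul_le_mul_right ?_ hx0
    nlinarith [mul_le_mul_of_nonneg_right h hk0]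

end WeightedLaplacian

/-- **Weighted Cheeger inequality**:
`λ₂/2 ≤ θ(ε,υ) ≤ √(2 λ₂ maxᵥ dᵥ/υᵥ)`. -/
theorem weighted_cheeger_inequality
    {V : Type} [Fintype V] [DecidableEq V]
    (ε : V → V → ℝ) (hsym : ∀ u v, ε u v = ε v u)
    (hnonneg : ∀ u v, 0 ≤ ε u v) (hdiag : ∀ v, ε v v = 0)
    (υ : V → ℝ) (hυ : ∀ v, 0 < υ v)
    (n : ℕ) (hn : n = Fintype.card V) (hn2 : 2 ≤ n)
    (lam : Fin n → ℝ) (hlamMono : Monotone lam)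
    (hlam : (wlap ε υ).charpoly = ∏ i, (X - C (lam i)))
    (M : ℝ) (hM : IsGreatest (Set.range fun v => (∑ u, ε v u) / υ v) M)
    (θc : ℝ)
    (hθc : IsLeast {x : ℝ | ∃ S : Finset V, S.Nonempty ∧ S ≠ Finset.univ ∧
      x = (∑ u ∈ S, ∑ v ∈ Sᶜ, ε u v) / min (∑ v ∈ S, υ v) (∑ v ∈ Sᶜ, υ v)} θc) :
    lam ⟨1, by omega⟩ / 2 ≤ θc ∧ θc ≤ Real.sqrt (2 * lam ⟨1, by omega⟩ * M) := by
  obtain ⟨b, hb⟩ := exists_isWeightedEigenbasis hsym hυ lam hlam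
  have hV : Nonempty V := Fintype.card_pos_iff.1 (by omega)
  obtain ⟨S, hS, hS', hSθ⟩ := hθc.1
  refine ⟨?_, ?_⟩
  · rw [hSθ]
    exact hb.second_eigenvalue_div_two_le hsym hnonneg hυ hlamMono hn2 hS hS'
  · have hθ0 : 0 ≤ θc := by
      rw [hSθ]
      exact div_nonneg
        (Finset.sum_nonneg fun u _ => Finset.sum_nonneg fun v _ => hnonneg u v)
        (le_min (Finset.sum_nonneg fun v _ => (hυ v).le)
          (Finset.sum_nonneg fun v _ => (hυ v).le))
    have hM' : ∀ v, ∑ u, ε v u ≤ M * υ v := fun v =>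
      (div_le_iff₀ (hυ v)).1 (hM.2 ⟨v, rfl⟩)
    have hM0 : 0 ≤ M := (div_nonneg (Finset.sum_nonneg fun u _ => hnonneg hV.some u)
      (hυ hV.some).le).trans (hM.2 ⟨hV.some, rfl⟩)
    have hθ : ∀ S : Finset V, S.Nonempty → S ≠ Finset.univ →
        θc * min (∑ v ∈ S, υ v) (∑ v ∈ Sᶜ, υ v) ≤ ∑ u ∈ S, ∑ v ∈ Sᶜ, ε u v := by
      intro S hS hS'
      have hSc : Sᶜ.Nonempty := by
        rwa [Finset.nonempty_iff_ne_empty, Ne, Finset.compl_eq_empty_iff]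
      exact (le_div_iff₀ (lt_min (Finset.sum_pos (fun v _ => hυ v) hS)
        (Finset.sum_pos (fun v _ => hυ v) hSc))).1 (hθc.2 ⟨S, hS, hS', rfl⟩)
    obtain ⟨g, hg, hg0, hgE⟩ := hb.exists_energy_le hsym hlamMono hn2
    have h1 := sq_mul_sum_sq_le_energy_of_sum_eq_zero hsym hnonneg hυ hθ0 hM0 hM' hθ g hg
    refine Real.le_sqrt_of_sq_le (le_of_mul_le_mul_right (h1.trans ?_) hg0)
    calc 2 * M * dirichletEnergy ε g
        ≤ 2 * M * (lam ⟨1, by omega⟩ * ∑ v, υ v * g v ^ 2) :=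
          mul_le_mul_of_nonneg_left hgE (by positivity)
      _ = 2 * lam ⟨1, by omega⟩ * M * ∑ v, υ v * g v ^ 2 := by ring
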